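/- For an absorbing finite-state Markov chain with fundamental matrix N = (I-Q)^{-1} and mean absorption time vector μ = N·1, the vector of variances of the absorption times is σ² = (2N - I)μ - μ∘μ, where μ∘μ denotes the entrywise square of μ. -/

import Mathlib

open Filter Matrix MeasureTheory

lemma aux_moment {Ω : Type*} [MeasurableSpace Ω] (μ : Measure Ω) [IsProbabilityMeasure μ]
    (T : Ω → ℕ) (hT : Measurable T) (w : ℕ → ℝ) (hw : ∀ t, 0 ≤ w t)
    (hI : Integrable (fun ω => ∑ t ∈ Finset.range (T ω), w t) μ) :
    Tendsto (fun n : ℕ => ∑ t ∈ Finset.range n, w t * (μ {ω | t < T ω}).toReal) atTop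
      (nhds (∫ ω, ∑ t ∈ Finset.range (T ω), w t ∂μ)) := by
  have hms : ∀ t : ℕ, MeasurableSet {ω | t < T ω} := fun t => measurableSet_lt measurable_const hT
  have hint : ∀ t : ℕ, Integrable (fun ω => w t * {ω | t < T ω}.indicator (fun _ => (1 : ℝ)) ω) μ :=
    fun t => ((integrable_const (1 : ℝ)).indicator (hms t)).const_mul _
  have h1 : ∀ n : ℕ, ∑ t ∈ Finset.range n, w t * (μ {ω | t < T ω}).toReal =
      ∫ ω, ∑ t ∈ Finset.range n, w t * {ω | t < T ω}.indicator (fun _ => (1 : ℝ)) ω ∂μ := by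
    intro n
    rw [integral_finsetSum _ (fun t _ => hint t)]
    refine Finset.sum_congr rfl fun t _ => ?_
    rw [integral_const_mul, integral_indicator (hms t)]
    simp [Measure.real]
  have h2 : ∀ (n : ℕ) ω, ∑ t ∈ Finset.range n, w t * {ω | t < T ω}.indicator (fun _ => (1 : ℝ)) ω
      = ∑ t ∈ Finset.range (min n (T ω)), w t := by
    intro n ω
    have : Finset.range (min n (T ω)) = (Finset.range n).filter (fun t => t < T ω) := by
      ext t; simp
    rw [this, Finset.sum_filter]
    refine Finset.sum_congr rfl fun t _ => ?_
    simp [Set.indicator_apply]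
  simp_rw [h1]
  refine tendsto_integral_of_dominated_convergence _ (fun n => ?_) hI (fun n => ?_) ?_
  · exact (integrable_finsetSum _ (fun t _ => hint t)).aestronglyMeasurable
  · refine Eventually.of_forall fun ω => ?_
    rw [h2, Real.norm_of_nonneg (Finset.sum_nonneg fun t _ => hw t)]
    exact Finset.sum_le_sum_of_subset_of_nonneg
      (Finset.range_mono (min_le_right _ _)) (fun t _ _ => hw t)
  · refine Eventually.of_forall fun ω => ?_
    refine tendsto_const_nhds.congr' ?_
    filter_upwards [eventually_ge_atTop (T ω)] with n hn
    rw [h2, min_eq_right hn]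

lemma aux_sq (n : ℕ) : ∑ t ∈ Finset.range n, (2 * (t : ℝ) + 1) = (n : ℝ) ^ 2 := by
  induction n with
  | zero => simp
  | succ k ih => rw [Finset.sum_range_succ, ih]; push_cast; ring

/-- For an absorbing finite-state Markov chain with fundamental matrix
`N = (I - Q)⁻¹` and mean absorption time vector `μvec = N·1`, the variance of
the absorption time from transient state `x` equals
`((2N - I)·μvec)_x - (μvec x)^2`, i.e. `σ² = (2N - I)μ - μ∘μ` entrywise. -/
theorem variance_absorption_time
    {ι : Type*} [Fintype ι] [DecidableEq ι] (Q : Matrix ι ι ℝ)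
    (hnonneg : ∀ i j, 0 ≤ Q i j)
    (hrowsum : ∀ i, ∑ j, Q i j ≤ 1)
    (hpow : Tendsto (fun t : ℕ => Q ^ t) atTop (nhds 0))
    {Ω : Type*} [MeasurableSpace Ω] (μ : Measure Ω) [IsProbabilityMeasure μ]
    (T : ι → Ω → ℕ) (hTmeas : ∀ x, Measurable (T x))
    (hTint : ∀ x, Integrable (fun ω => (T x ω : ℝ)) μ)
    (hTsqint : ∀ x, Integrable (fun ω => (T x ω : ℝ) ^ 2) μ)
    (htail : ∀ x (t : ℕ), (μ {ω | t < T x ω}).toReal = ((Q ^ t) *ᵥ (fun _ => (1 : ℝ))) x) :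
    ∀ x, (∫ ω, ((T x ω : ℝ) - ∫ ω', (T x ω' : ℝ) ∂μ) ^ 2 ∂μ) =
      ((2 • (1 - Q)⁻¹ - 1) *ᵥ ((1 - Q)⁻¹ *ᵥ (fun _ => (1 : ℝ)))) x
        - (((1 - Q)⁻¹ *ᵥ (fun _ => (1 : ℝ))) x) ^ 2 := by
  have hunit : IsUnit (1 - Q).det := by
    rw [isUnit_iff_ne_zero]
    intro h0
    obtain ⟨v, hv0, hv⟩ := Matrix.exists_mulVec_eq_zero_iff.mpr h0
    apply hv0
    have hQv : Q *ᵥ v = v := by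
      rw [Matrix.sub_mulVec, Matrix.one_mulVec, sub_eq_zero] at hv
      exact hv.symm
    have hQt : ∀ t : ℕ, (Q ^ t) *ᵥ v = v := by
      intro t
      induction t with
      | zero => simp
      | succ k ih => rw [pow_succ, ← Matrix.mulVec_mulVec, hQv, ih]
    have hc : Continuous fun A : Matrix ι ι ℝ => A *ᵥ v := by fun_prop
    have hlim := (hc.tendsto 0).comp hpow
    simp only [Function.comp_def, hQt, Matrix.zero_mulVec] at hlim
    exact tendsto_nhds_unique tendsto_const_nhds hlim
  obtain ⟨p, hp⟩ : ∃ p : ℕ → ι → ℝ, p = fun t => (Q ^ t) *ᵥ (fun _ => (1 : ℝ)) := ⟨_, rfl⟩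
  have hp0 : p 0 = fun _ => (1 : ℝ) := by simp [hp]
  have hps : ∀ t, Q *ᵥ p t = p (t + 1) := by
    intro t
    simp only [hp]
    rw [Matrix.mulVec_mulVec, ← pow_succ']
  have hpt : ∀ x (t : ℕ), (μ {ω | t < T x ω}).toReal = p t x := by
    intro x t; rw [htail, hp]
  obtain ⟨m1, hm1⟩ : ∃ m : ι → ℝ, m = fun x => ∫ ω, (T x ω : ℝ) ∂μ := ⟨_, rfl⟩
  obtain ⟨m2, hm2⟩ : ∃ m : ι → ℝ, m = fun x => ∫ ω, (T x ω : ℝ) ^ 2 ∂μ := ⟨_, rfl⟩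
  have hS : Tendsto (fun n : ℕ => ∑ t ∈ Finset.range n, p t) atTop (nhds m1) := by
    rw [tendsto_pi_nhds]
    intro x
    have := aux_moment μ (T x) (hTmeas x) (fun _ => 1) (fun _ => zero_le_one)
      (by simpa using hTint x)
    simpa [hpt, hm1] using this
  have hA : Tendsto (fun n : ℕ => ∑ t ∈ Finset.range n, (2 * (t : ℝ) + 1) • p t) atTop
      (nhds m2) := by
    rw [tendsto_pi_nhds]
    intro x
    have := aux_moment μ (T x) (hTmeas x) (fun t => 2 * (t : ℝ) + 1) (fun _ => by positivity)
      (by simpa only [aux_sq] using hTsqint x)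
    simp only [aux_sq, hpt] at this
    simpa [hm2] using this
  have hP : Tendsto p atTop (nhds 0) := by
    have := ((tendsto_add_atTop_iff_nat 1).2 hS).sub hS
    simpa [Finset.sum_range_succ] using this
  have hP2 : Tendsto (fun n : ℕ => (2 * (n : ℝ) + 1) • p n) atTop (nhds 0) := by
    have := ((tendsto_add_atTop_iff_nat 1).2 hA).sub hA
    simpa [Finset.sum_range_succ] using this
  have hc : Continuous fun v : ι → ℝ => (1 - Q) *ᵥ v := by fun_prop
  have e1 : ∀ n : ℕ, (1 - Q) *ᵥ (∑ t ∈ Finset.range n, p t) = p 0 - p n := by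
    intro n
    induction n with
    | zero => simp
    | succ k ih =>
      rw [Finset.sum_range_succ, Matrix.mulVec_add, ih, Matrix.sub_mulVec, Matrix.one_mulVec, hps]
      abel
  have e2 : ∀ n : ℕ, (1 - Q) *ᵥ (∑ t ∈ Finset.range n, (2 * (t : ℝ) + 1) • p t) =
      (2 : ℝ) • (∑ t ∈ Finset.range n, p t) - p 0 - ((2 * (n : ℝ) + 1) • p n - (2 : ℝ) • p n) := by
    intro n
    induction n with
    | zero => ext x; simp; ring
    | succ k ih =>
      rw [Finset.sum_range_succ, Matrix.mulVec_add, ih, Matrix.mulVec_smul, Matrix.sub_mulVec,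
        Matrix.one_mulVec, hps, Finset.sum_range_succ]
      push_cast
      module
  have f1 : (1 - Q) *ᵥ m1 = p 0 := by
    have h1 := (hc.tendsto m1).comp hS
    have h2 : Tendsto (fun n => p 0 - p n) atTop (nhds (p 0 - 0)) := tendsto_const_nhds.sub hP
    simp only [Function.comp_def, e1] at h1
    rw [tendsto_nhds_unique h1 h2, sub_zero]
  have f2 : (1 - Q) *ᵥ m2 = (2 : ℝ) • m1 - p 0 := by
    have h1 := (hc.tendsto m2).comp hA
    have h2 := ((hS.const_smul (2 : ℝ)).sub (tendsto_const_nhds (x := p 0))).sub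
      (hP2.sub (hP.const_smul (2 : ℝ)))
    simp only [Function.comp_def, e2] at h1
    rw [tendsto_nhds_unique h1 h2]
    simp
  have inv : ∀ v : ι → ℝ, (1 - Q)⁻¹ *ᵥ ((1 - Q) *ᵥ v) = v := by
    intro v
    rw [Matrix.mulVec_mulVec, Matrix.nonsing_inv_mul _ hunit, Matrix.one_mulVec]
  have g1 : (1 - Q)⁻¹ *ᵥ (fun _ => (1 : ℝ)) = m1 := by rw [← hp0, ← f1, inv]
  have g2 : m2 = (2 : ℝ) • ((1 - Q)⁻¹ *ᵥ m1) - m1 := by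
    rw [← inv m2, f2, Matrix.mulVec_sub, Matrix.mulVec_smul, hp0, g1]
  intro x
  have g3 : ((2 • (1 - Q)⁻¹ - 1) *ᵥ m1) = m2 := by
    rw [g2, Matrix.sub_mulVec, Matrix.one_mulVec, two_smul, two_smul, Matrix.add_mulVec]
  rw [g1, g3]
  have hx : ∫ ω', (T x ω' : ℝ) ∂μ = m1 x := by rw [hm1]
  have hx2 : ∫ ω', (T x ω' : ℝ) ^ 2 ∂μ = m2 x := by rw [hm2]
  rw [hx]
  have hexp : ∀ ω, ((T x ω : ℝ) - m1 x) ^ 2 =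
      (T x ω : ℝ) ^ 2 - (2 * m1 x) * (T x ω : ℝ) + m1 x ^ 2 := fun ω => by ring
  simp_rw [hexp]
  have hsub : Integrable (fun ω => (T x ω : ℝ) ^ 2 - (2 * m1 x) * (T x ω : ℝ)) μ :=
    (hTsqint x).sub ((hTint x).const_mul _)
  rw [integral_add hsub (integrable_const _),
    integral_sub (hTsqint x) ((hTint x).const_mul _), integral_const_mul, hx, hx2]
  simp
  ring
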